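/- Let r₁ ≥ 0 and r₂, r₃, r₇ be integers with 0 ≤ r₂ ≤ 1, 0 ≤ r₃ ≤ 2, and r₇ ∈ {0, 3, 6}. Then for every irreducible complex character χ of G, r₁χ(1) + Σ_{k=1}^{r₂} ⟨χ|_{H₂}, θ₂^{−k}⟩ + Σ_{k=1}^{r₃} ⟨χ|_{H₃}, θ₃^{−k}⟩ + Σ_{k=1}^{r₇} ⟨χ|_{H₇}, θ₇^{−k}⟩ = (r₁ + r₂ + r₃/2 + r₇/6)·χ(1) − r₂·dim χ^{H₂} − (r₃/2)·dim χ^{H₃} − (r₇/6)·dim χ^{H₇}; that is, the multiplicity of χ in the equivariant degree deg_eq(r₁D₁ + r₂D₂ + r₃D₃ + r₇D₇) equals the right-hand side. -/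

import Mathlib

open scoped BigOperators Classical

noncomputable section

/-- The projective special linear group `PSL(2, F) = SL(2, F)/{±I}` (for `F` a finite
field of odd characteristic the center of `SL(2,F)` is exactly `{±I}`). -/
abbrev PSL2 (F : Type) [Field F] : Type :=
  Matrix.SpecialLinearGroup (Fin 2) F ⧸ Subgroup.center (Matrix.SpecialLinearGroup (Fin 2) F)

/-- `χ` is the character of some finite-dimensional complex representation of `G`. -/
def IsCharacter (G : Type) [Group G] (χ : G → ℂ) : Prop :=
  ∃ V : FDRep ℂ G, V.character = χ

/-- `χ` is an irreducible complex character of `G`. -/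
def IsIrrCharacter (G : Type) [Group G] (χ : G → ℂ) : Prop :=
  ∃ V : FDRep ℂ G, CategoryTheory.Simple V ∧ V.character = χ

/-- `⟨χ|_H, θ⟩ = (1/|H|) ∑_{h ∈ H} χ(h) θ(h)⁻¹`, the multiplicity of the linear
character `θ` of `H` in the restriction `χ|_H`. -/
def restMult {G : Type} [Group G] [Finite G] (H : Subgroup G) (θ : H →* ℂˣ) (χ : G → ℂ) : ℂ :=
  letI : Fintype H := Fintype.ofFinite H
  (Nat.card H : ℂ)⁻¹ * ∑ h : H, χ h * ((θ h : ℂ))⁻¹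

/-- `dim χ^H = (1/|H|) ∑_{h ∈ H} χ(h)`, the dimension of the `H`-fixed subspace. -/
def dimFixed {G : Type} [Group G] [Finite G] (H : Subgroup G) (χ : G → ℂ) : ℂ :=
  letI : Fintype H := Fintype.ofFinite H
  (Nat.card H : ℂ)⁻¹ * ∑ h : H, χ h

/-- The ramification multiplicity
`Γ(χ) = (1/2)⟨χ|_{H₂},θ₂⟩ + (1/3)(⟨χ|_{H₃},θ₃⟩ + 2⟨χ|_{H₃},θ₃²⟩)
  + (1/7)∑_{k=1}^{6} k ⟨χ|_{H₇},θ₇^k⟩`. -/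
def ramMult {G : Type} [Group G] [Finite G] (H2 H3 H7 : Subgroup G)
    (θ2 : H2 →* ℂˣ) (θ3 : H3 →* ℂˣ) (θ7 : H7 →* ℂˣ) (χ : G → ℂ) : ℂ :=
  (1/2) * restMult H2 θ2 χ
    + (1/3) * (restMult H3 θ3 χ + 2 * restMult H3 (θ3 ^ 2) χ)
    + (1/7) * ∑ k ∈ Finset.Icc (1:ℕ) 6, (k : ℂ) * restMult H7 (θ7 ^ k) χ

/-- The base multiplicity `m = (q−ε₂)/4 + (q−ε₃)/3 + 3(q−ε₇)/7`, where
`ε_ℓ = 1` if `q ≡ 1 (mod ℓ')` and `ε_ℓ = −1` otherwise. -/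
def baseMult (q : ℕ) : ℤ :=
  ((q : ℤ) - (if q % 4 = 1 then 1 else -1)) / 4
    + ((q : ℤ) - (if q % 3 = 1 then 1 else -1)) / 3
    + 3 * (((q : ℤ) - (if q % 7 = 1 then 1 else -1)) / 7)

end

section CharacterSums

variable {G : Type} [Group G] [Finite G] {H : Subgroup G} {χ : G → ℂ}

theorem restMult_inv (hχ : ∀ h ∈ H, χ h⁻¹ = χ h) (θ : H →* ℂˣ) :
    restMult H θ⁻¹ χ = restMult H θ χ := by
  let _ : Fintype H := Fintype.ofFinite H
  unfold restMult
  congr 1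
  refine Fintype.sum_equiv (Equiv.inv H) _ _ fun h => ?_
  simp [hχ h h.2]

theorem sum_Icc_restMult_zpow_neg {θ : H →* ℂˣ} (hθ : Function.Injective θ) (χ : G → ℂ)
    {m : ℕ} (hm : m + 1 = Nat.card H) :
    ∑ k ∈ Finset.Icc 1 m, restMult H (θ ^ (-(k : ℤ))) χ = χ 1 - dimFixed H χ := by
  let _ : Fintype H := Fintype.ofFinite H
  have hcard : (Nat.card H : ℂ) ≠ 0 := Nat.cast_ne_zero.2 Nat.card_pos.ne'
  have hgeom : ∀ h : H, ∑ k ∈ Finset.Icc 1 m, (θ h : ℂ) ^ k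
      = (if h = 1 then (Nat.card H : ℂ) else 0) - 1 := by
    intro h
    have hsplit : ∑ k ∈ Finset.range (Nat.card H), (θ h : ℂ) ^ k
        = ∑ k ∈ Finset.Icc 1 m, (θ h : ℂ) ^ k + 1 := by
      rw [← hm, Finset.sum_range_succ', pow_zero, Finset.range_eq_Ico,
        Finset.sum_Ico_add' (fun k => (θ h : ℂ) ^ k) 0 m 1, zero_add]
      rfl
    rw [eq_sub_iff_add_eq, ← hsplit]
    split_ifs with hh
    · simp [hh]
    · have hne : (θ h : ℂ) ≠ 1 := fun h1 => hh (hθ (by simpa using Units.ext h1))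
      have hpow : (θ h : ℂ) ^ Nat.card H = 1 := by
        rw [← Units.val_pow_eq_pow_val, ← map_pow, pow_card_eq_one', map_one, Units.val_one]
      rw [geom_sum_eq hne, hpow, sub_self, zero_div]
  have hterm : ∀ k : ℕ, restMult H (θ ^ (-(k : ℤ))) χ
      = (Nat.card H : ℂ)⁻¹ * ∑ h : H, χ h * (θ h : ℂ) ^ k := by
    intro k
    simp [restMult]
  simp_rw [hterm]
  rw [← Finset.mul_sum, Finset.sum_comm]
  simp_rw [← Finset.mul_sum, hgeom, mul_sub, mul_one]
  rw [Finset.sum_sub_distrib, mul_sub]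
  congr 1
  simp only [mul_ite, mul_zero, Finset.sum_ite_eq', Finset.mem_univ, if_true,
    OneMemClass.coe_one]
  field_simp

theorem restMult_zpow_neg_of_add_eq_card (hχ : ∀ h ∈ H, χ h⁻¹ = χ h) (θ : H →* ℂˣ)
    {j k : ℕ} (hjk : j + k = Nat.card H) :
    restMult H (θ ^ (-(j : ℤ))) χ = restMult H (θ ^ (-(k : ℤ))) χ := by
  rw [← restMult_inv hχ (θ ^ (-(k : ℤ)))]
  congr 1
  refine MonoidHom.ext fun h => ?_
  rw [MonoidHom.inv_apply, MonoidHom.zpow_apply, MonoidHom.zpow_apply, zpow_neg, zpow_neg,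
    inv_inv, inv_eq_iff_mul_eq_one, zpow_natCast, zpow_natCast, ← pow_add, hjk, ← map_pow,
    pow_card_eq_one', map_one]

end CharacterSums

section Reality

variable {F : Type} [Field F] [Fintype F]

/-- A nondegenerate binary quadratic form over a finite field of odd order represents every
element; here it is the negated determinant on the trace-zero matrices orthogonal to a
regular semisimple matrix with entries `a`, `b`, `c`, `d`. -/
theorem exists_traceless_orthogonal (hodd : Fintype.card F % 2 = 1) (a b c d : F)
    (hD : (a - d) ^ 2 + 4 * (b * c) ≠ 0) :
    ∃ u v w : F, u * (a - d) + v * c + w * b = 0 ∧ u ^ 2 + v * w = -1 := by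
  have h2 : (2 : F) ≠ 0 := Ring.two_ne_zero fun h => by
    have := FiniteField.even_card_iff_char_two.1 h
    omega
  by_cases hc : c = 0
  · by_cases hb : b = 0
    · exact ⟨0, 1, -1, by simp [hb, hc], by ring⟩
    · have had : a - d ≠ 0 := by
        rintro h
        simp [h, hc] at hD
      refine ⟨1, 2 * b / (a - d), -(a - d) / b, ?_, ?_⟩
      · rw [hc]
        field_simp
        ring
      · field_simp
        ring
  · obtain ⟨x, w, hxw⟩ := FiniteField.exists_root_sum_quadratic
      (f := Polynomial.C 1 * Polynomial.X ^ 2 + Polynomial.C 0 * Polynomial.X + Polynomial.C 0)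
      (g := Polynomial.C (-((a - d) ^ 2 + 4 * (b * c))) * Polynomial.X ^ 2
        + Polynomial.C 0 * Polynomial.X + Polynomial.C (4 * c ^ 2))
      (Polynomial.degree_quadratic one_ne_zero)
      (Polynomial.degree_quadratic (neg_ne_zero.2 hD)) hodd
    simp only [Polynomial.eval_add, Polynomial.eval_mul, Polynomial.eval_C, Polynomial.eval_pow,
      Polynomial.eval_X] at hxw
    refine ⟨(x + (a - d) * w) / (2 * c),
      -((x + (a - d) * w) / (2 * c) * (a - d) + w * b) / c, w, ?_, ?_⟩
    · field_simp
      ring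
    · field_simp
      linear_combination hxw

open Matrix in
theorem exists_conj_eq_inv_of_trace_sq_ne_four (hodd : Fintype.card F % 2 = 1)
    (g : SpecialLinearGroup (Fin 2) F) (hg : (g : Matrix (Fin 2) (Fin 2) F).trace ^ 2 ≠ 4) :
    ∃ x, x * g * x⁻¹ = g⁻¹ := by
  have hdet := g.det_coe
  rw [det_fin_two] at hdet
  rw [trace_fin_two] at hg
  obtain ⟨u, v, w, h1, h2⟩ := exists_traceless_orthogonal hodd (g 0 0) (g 0 1) (g 1 0) (g 1 1)
    (fun h => hg (by linear_combination h + 4 * hdet))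
  have hx : (!![u, v; w, -u]).det = 1 := by
    rw [det_fin_two_of]
    linear_combination -h2
  let x : SpecialLinearGroup (Fin 2) F := ⟨!![u, v; w, -u], hx⟩
  have hcoe : (x : Matrix (Fin 2) (Fin 2) F) = !![u, v; w, -u] := rfl
  refine ⟨x, mul_inv_eq_of_eq_mul ?_⟩
  ext i j
  fin_cases i <;> fin_cases j <;>
    simp [hcoe, adjugate_fin_two, mul_apply,
      Fin.sum_univ_two] <;>
    first | ring1 | linear_combination h1

open Matrix in
theorem pow_card_mem_center_of_trace_sq_eq_four (g : SpecialLinearGroup (Fin 2) F)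
    (hg : (g : Matrix (Fin 2) (Fin 2) F).trace ^ 2 = 4) :
    g ^ Fintype.card F ∈ Subgroup.center (SpecialLinearGroup (Fin 2) F) := by
  obtain ⟨ε, hε, hε2⟩ : ∃ ε : F, (g : Matrix (Fin 2) (Fin 2) F).trace = 2 * ε ∧ ε ^ 2 = 1 := by
    have : ((g : Matrix (Fin 2) (Fin 2) F).trace - 2)
        * ((g : Matrix (Fin 2) (Fin 2) F).trace + 2) = 0 := by linear_combination hg
    rcases mul_eq_zero.1 this with h | h
    · exact ⟨1, by linear_combination h, by ring⟩
    · exact ⟨-1, by linear_combination h, by ring⟩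
  have hdet := g.det_coe
  rw [det_fin_two] at hdet
  rw [trace_fin_two] at hε
  have hnil : ((g : Matrix (Fin 2) (Fin 2) F) - scalar (Fin 2) ε) ^ 2 = 0 := by
    rw [pow_two]
    ext i j
    fin_cases i <;> fin_cases j <;>
      simp [mul_apply, Fin.sum_univ_two, Matrix.sub_apply] <;> grind
  obtain ⟨p, hp⟩ := CharP.exists F
  obtain ⟨n, hprime, hn⟩ := FiniteField.card F p
  have := Fact.mk hprime
  have hpow : ((g : Matrix (Fin 2) (Fin 2) F) - scalar (Fin 2) ε) ^ Fintype.card F = 0 :=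
    pow_eq_zero_of_le Fintype.one_lt_card hnil
  rw [hn, sub_pow_char_pow_of_commute p _
    (scalar_commute ε (fun r => Commute.all _ _) _).symm, ← hn, sub_eq_zero, ← map_pow] at hpow
  rw [Matrix.SpecialLinearGroup.mem_center_iff]
  refine ⟨ε ^ Fintype.card F, ?_, ?_⟩
  · rw [Fintype.card_fin, ← pow_mul, mul_comm, pow_mul, hε2, one_pow]
  · exact hpow.symm.trans (Matrix.SpecialLinearGroup.coe_pow g _).symm

theorem exists_conj_eq_inv_of_pow_eq_one {n : ℕ} (hodd : Fintype.card F % 2 = 1)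
    (hn : Nat.Coprime (Fintype.card F) n) (y : PSL2 F) (hy : y ^ n = 1) :
    ∃ x, x * y * x⁻¹ = y⁻¹ := by
  obtain ⟨g, rfl⟩ := QuotientGroup.mk_surjective y
  by_cases hg : (g : Matrix (Fin 2) (Fin 2) F).trace ^ 2 = 4
  · have hcard : (QuotientGroup.mk g : PSL2 F) ^ Fintype.card F = 1 := by
      rw [← QuotientGroup.mk_pow]
      exact (QuotientGroup.eq_one_iff _).2 (pow_card_mem_center_of_trace_sq_eq_four g hg)
    have hone : (QuotientGroup.mk g : PSL2 F) = 1 := by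
      rw [← orderOf_eq_one_iff, ← Nat.dvd_one, ← hn]
      exact Nat.dvd_gcd (orderOf_dvd_of_pow_eq_one hcard) (orderOf_dvd_of_pow_eq_one hy)
    exact ⟨1, by simp [hone]⟩
  · obtain ⟨x, hx⟩ := exists_conj_eq_inv_of_trace_sq_ne_four hodd g hg
    exact ⟨QuotientGroup.mk x, by
      rw [← QuotientGroup.mk_inv, ← QuotientGroup.mk_inv, ← hx]; rfl⟩

theorem IsIrrCharacter.apply_conj {G : Type} [Group G] {χ : G → ℂ} (hχ : IsIrrCharacter G χ)
    (x y : G) : χ (x * y * x⁻¹) = χ y := by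
  obtain ⟨V, -, rfl⟩ := hχ
  exact V.char_conj y x

theorem IsIrrCharacter.apply_inv_of_mem {χ : PSL2 F → ℂ} (hχ : IsIrrCharacter (PSL2 F) χ)
    (hodd : Fintype.card F % 2 = 1) {H : Subgroup (PSL2 F)}
    (hH : Nat.Coprime (Fintype.card F) (Nat.card H)) : ∀ h ∈ H, χ h⁻¹ = χ h := by
  intro h hh
  obtain ⟨x, hx⟩ := exists_conj_eq_inv_of_pow_eq_one hodd hH h
    (congrArg Subtype.val (pow_card_eq_one' (x := (⟨h, hh⟩ : H))))
  rw [← hx, hχ.apply_conj]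

end Reality

theorem equivariant_degree_formula
    (q : ℕ) (hq : IsPrimePow q) (hgcd : Nat.Coprime q 42)
    (hq7 : q % 7 = 1 ∨ q % 7 = 6)
    (F : Type) [Field F] [Fintype F] (hF : Fintype.card F = q)
    (H2 H3 H7 : Subgroup (PSL2 F))
    (hH2 : Nat.card H2 = 2) (hH3 : Nat.card H3 = 3) (hH7 : Nat.card H7 = 7)
    (θ2 : H2 →* ℂˣ) (θ3 : H3 →* ℂˣ) (θ7 : H7 →* ℂˣ)
    (hθ2 : Function.Injective θ2) (hθ3 : Function.Injective θ3)
    (hθ7 : Function.Injective θ7)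
    (r1 r2 r3 r7 : ℕ) (hr2 : r2 ≤ 1) (hr3 : r3 ≤ 2) (hr7 : r7 = 0 ∨ r7 = 3 ∨ r7 = 6)
    (χ : PSL2 F → ℂ) (hχ : IsIrrCharacter (PSL2 F) χ)
    :
    (r1 : ℂ) * χ 1 + (∑ k ∈ Finset.Icc 1 r2, restMult H2 (θ2 ^ (-(k : ℤ))) χ)
      + (∑ k ∈ Finset.Icc 1 r3, restMult H3 (θ3 ^ (-(k : ℤ))) χ)
      + (∑ k ∈ Finset.Icc 1 r7, restMult H7 (θ7 ^ (-(k : ℤ))) χ) =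
      ((r1 : ℂ) + (r2 : ℂ) + (r3 : ℂ) / 2 + (r7 : ℂ) / 6) * χ 1
        - (r2 : ℂ) * dimFixed H2 χ - ((r3 : ℂ) / 2) * dimFixed H3 χ
        - ((r7 : ℂ) / 6) * dimFixed H7 χ := by
  have hcop : ∀ m, m ∣ 42 → Nat.Coprime (Fintype.card F) m := fun m hm =>
    hF ▸ hgcd.coprime_dvd_right hm
  have hodd : Fintype.card F % 2 = 1 :=
    Nat.odd_iff.1 ((Nat.coprime_two_right).1 (hcop 2 (by norm_num)))
  have hinv3 := hχ.apply_inv_of_mem hodd (H := H3) (hH3 ▸ hcop 3 (by norm_num))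
  have hinv7 := hχ.apply_inv_of_mem hodd (H := H7) (hH7 ▸ hcop 7 (by norm_num))
  have symm3 := restMult_zpow_neg_of_add_eq_card hinv3 θ3 (j := 1) (k := 2) hH3.symm
  have symm7₁ := restMult_zpow_neg_of_add_eq_card hinv7 θ7 (j := 1) (k := 6) hH7.symm
  have symm7₂ := restMult_zpow_neg_of_add_eq_card hinv7 θ7 (j := 2) (k := 5) hH7.symm
  have symm7₃ := restMult_zpow_neg_of_add_eq_card hinv7 θ7 (j := 3) (k := 4) hH7.symm
  have e2 : ∑ k ∈ Finset.Icc 1 r2, restMult H2 (θ2 ^ (-(k : ℤ))) χ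
      = (r2 : ℂ) * (χ 1 - dimFixed H2 χ) := by
    interval_cases r2
    · simp
    · rw [sum_Icc_restMult_zpow_neg hθ2 χ hH2.symm, Nat.cast_one, one_mul]
  have e3 : ∑ k ∈ Finset.Icc 1 r3, restMult H3 (θ3 ^ (-(k : ℤ))) χ
      = (r3 : ℂ) / 2 * (χ 1 - dimFixed H3 χ) := by
    rw [← sum_Icc_restMult_zpow_neg hθ3 χ (m := 2) hH3.symm]
    interval_cases r3
    · simp
    · rw [Finset.Icc_self, Finset.sum_singleton, Finset.sum_Icc_succ_top (by norm_num),
        Finset.Icc_self, Finset.sum_singleton]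
      linear_combination symm3 / 2
    · norm_num
  have e7 : ∑ k ∈ Finset.Icc 1 r7, restMult H7 (θ7 ^ (-(k : ℤ))) χ
      = (r7 : ℂ) / 6 * (χ 1 - dimFixed H7 χ) := by
    rw [← sum_Icc_restMult_zpow_neg hθ7 χ (m := 6) hH7.symm]
    rcases hr7 with rfl | rfl | rfl
    · simp
    · have h6 : Finset.Icc 1 6 = {1, 2, 3, 4, 5, 6} := rfl
      have h3 : Finset.Icc 1 3 = {1, 2, 3} := rfl
      rw [h6, h3]
      repeat rw [Finset.sum_insert (by decide)]
      rw [Finset.sum_singleton, Finset.sum_singleton]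
      linear_combination (symm7₁ + symm7₂ + symm7₃) / 2
    · norm_num
  rw [e2, e3, e7]
  ring
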